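/- Let β > 0, ρ ∈ [0, 1/2], μ ∈ (0, 2π]. For k ∈ ℕ and 0 ≤ s ≤ k set g_{k,s}(θ) = C(β, k)·C(k, s)·(1/(2π))^(β−k)·(ρ/π)^k·θ^(β−k)·[ (sin μ)^s·(sin(θ − μ))^(k−s+1)·M₀(θ) + (sin μ)^(k−s)·(sin(θ − μ))^(s+1)·M₁(θ) ], where M₀(θ) = 1 if |sin(θ − μ)| ≥ |sin(μ)| and 0 otherwise, and M₁ = 1 − M₀. Assume each g_{k,s} is integrable on (0, 2π) and ∑_{k=0}^∞ ∑_{s=0}^{k} ∫₀^{2π} |g_{k,s}(θ)| dθ < ∞. Then the first cosine moment satisfies α₁ := ∫₀^{2π} cos(θ − μ)·f(θ) dθ = cos(μ) + ∑_{k=0}^∞ ∑_{s=0}^{k} ∫₀^{2π} g_{k,s}(θ) dθ. -/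

import Mathlib

open Real MeasureTheory

/-- Generalized binomial coefficient `C(β, k) = β (β-1) ⋯ (β-k+1) / k!`. -/
noncomputable def genBinom (β : ℝ) (k : ℕ) : ℝ :=
  (∏ i ∈ Finset.range k, (β - i)) / (Nat.factorial k)

theorem genBinom_eq_choose (β : ℝ) (k : ℕ) : genBinom β k = Ring.choose β k := by
  rw [Ring.choose_eq_smul, Polynomial.descPochhammer_smeval_eq_ascPochhammer,
    Polynomial.ascPochhammer_smeval_eq_eval, ← descPochhammer_eval_eq_ascPochhammer,
    descPochhammer_eval_eq_prod_range, genBinom, smul_eq_mul, div_eq_inv_mul]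

theorem genBinom_hasSum (β z : ℝ) (hz : |z| < 1) :
    HasSum (fun k : ℕ => genBinom β k * z ^ k) ((1 + z) ^ β) := by
  have h := (Real.one_add_rpow_hasFPowerSeriesOnBall_zero (a := β)).hasSum (y := z)
    (by
      rw [Metric.mem_eball, edist_zero_right, ← ofReal_norm, Real.norm_eq_abs]
      exact ENNReal.ofReal_lt_one.2 hz)
  simp only [binomialSeries_apply, List.ofFn_const, List.prod_replicate, smul_eq_mul,
    zero_add] at h
  simpa only [genBinom_eq_choose] using h

/-- the perturbation is strictly smaller than the linear term -/
theorem ec_abs_lt (ρ μ θ : ℝ) (hρ0 : 0 ≤ ρ) (hρ1 : ρ ≤ 1 / 2) (h0 : 0 < θ)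
    (h1 : θ < 2 * π) :
    |(ρ / π) * (Real.sin (θ - μ) + Real.sin μ)| < θ / (2 * π) := by
  have hpi := Real.pi_pos
  have e : Real.sin (θ - μ) + Real.sin μ = 2 * (Real.sin (θ / 2) * Real.cos (θ / 2 - μ)) := by
    have := Real.sin_sub_sin (θ - μ) (-μ)
    rw [Real.sin_neg] at this
    rw [show (θ - μ - -μ) / 2 = θ / 2 by ring, show (θ - μ + -μ) / 2 = θ / 2 - μ by ring] at this
    linarith
  have hs : 0 < Real.sin (θ / 2) := Real.sin_pos_of_pos_of_lt_pi (by linarith) (by linarith)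
  have hs2 : Real.sin (θ / 2) < θ / 2 := Real.sin_lt (by linarith)
  have hb : |Real.sin (θ - μ) + Real.sin μ| < θ := by
    rw [e, abs_mul, abs_mul, abs_of_pos hs, abs_two]
    have := Real.abs_cos_le_one (θ / 2 - μ)
    nlinarith
  rw [abs_mul, abs_of_nonneg (by positivity), div_mul_eq_mul_div,
    div_lt_div_iff₀ hpi (by positivity)]
  have := abs_nonneg (Real.sin (θ - μ) + Real.sin μ)
  have h3 : ρ * |Real.sin (θ - μ) + Real.sin μ| * 2 < θ := by nlinarith
  nlinarith

/-- integration by parts -/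
theorem ec_parts (β ρ μ : ℝ) (hβ : 0 < β) (hρ0 : 0 ≤ ρ) (hρ1 : ρ ≤ 1 / 2) :
    ∫ θ in (0 : ℝ)..(2 * π),
        Real.cos (θ - μ) *
          ((β / (2 * π)) *
            (θ / (2 * π) + (ρ / π) * (Real.sin (θ - μ) + Real.sin μ)) ^ (β - 1) *
            (1 + 2 * ρ * Real.cos (θ - μ))) =
      Real.cos μ + ∫ θ in (0 : ℝ)..(2 * π), Real.sin (θ - μ) *
        (θ / (2 * π) + (ρ / π) * (Real.sin (θ - μ) + Real.sin μ)) ^ β := by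
  have hpi := Real.pi_pos
  have hle : (0 : ℝ) ≤ 2 * π := by positivity
  have hpos : ∀ θ ∈ Set.Ioo (0 : ℝ) (2 * π),
      0 < θ / (2 * π) + (ρ / π) * (Real.sin (θ - μ) + Real.sin μ) := by
    intro θ hθ
    have := (abs_lt.1 (ec_abs_lt ρ μ θ hρ0 hρ1 hθ.1 hθ.2)).1
    linarith
  have hv : Continuous fun θ : ℝ =>
      (θ / (2 * π) + (ρ / π) * (Real.sin (θ - μ) + Real.sin μ)) ^ β :=
    Continuous.rpow_const (by fun_prop) (fun _ => Or.inr hβ.le)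
  have hd : ∀ θ ∈ Set.Ioo (min (0 : ℝ) (2 * π)) (max 0 (2 * π)), HasDerivAt (fun θ : ℝ =>
      (θ / (2 * π) + (ρ / π) * (Real.sin (θ - μ) + Real.sin μ)) ^ β)
      ((β / (2 * π)) *
            (θ / (2 * π) + (ρ / π) * (Real.sin (θ - μ) + Real.sin μ)) ^ (β - 1) *
            (1 + 2 * ρ * Real.cos (θ - μ))) θ := by
    intro θ hθ
    rw [min_eq_left hle, max_eq_right hle] at hθ
    have h1 : HasDerivAt (fun θ : ℝ => θ / (2 * π) + (ρ / π) * (Real.sin (θ - μ) + Real.sin μ))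
        (1 / (2 * π) + (ρ / π) * (Real.cos (θ - μ) * 1)) θ :=
      ((hasDerivAt_id θ).div_const _).add
        (((((hasDerivAt_id θ).sub_const μ).sin).add_const _).const_mul _)
    convert h1.rpow_const (p := β) (Or.inl (hpos θ hθ).ne') using 1
    field_simp
  have hi := intervalIntegral.intervalIntegrable_deriv_of_nonneg hv.continuousOn hd (by
    intro θ hθ
    rw [min_eq_left hle, max_eq_right hle] at hθ
    have := (hpos θ hθ).le
    have h2 := Real.neg_one_le_cos (θ - μ)
    have h3 : 0 ≤ 1 + 2 * ρ * Real.cos (θ - μ) := by nlinarith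
    positivity)
  have hu : ∀ θ : ℝ, HasDerivAt (fun θ => Real.cos (θ - μ)) (-Real.sin (θ - μ)) θ := by
    intro θ
    simpa using ((hasDerivAt_id θ).sub_const μ).cos
  rw [intervalIntegral.integral_mul_deriv_eq_deriv_mul_of_hasDerivAt
    (u := fun θ => Real.cos (θ - μ)) (u' := fun θ => -Real.sin (θ - μ))
    (by fun_prop) hv.continuousOn (fun x _ => hu x) hd
    (Continuous.intervalIntegrable (by fun_prop) _ _) hi]
  have e1 : (2 * π) / (2 * π) = 1 := div_self (by positivity)
  have e2 : Real.sin (2 * π - μ) = - Real.sin μ := Real.sin_two_pi_sub μ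
  have e3 : Real.cos (2 * π - μ) = Real.cos μ := Real.cos_two_pi_sub μ
  simp only [neg_mul, intervalIntegral.integral_neg, e1, e2, e3]
  simp [Real.zero_rpow hβ.ne']

theorem ec_first_cos_moment (β ρ μ : ℝ) (hβ : 0 < β) (hρ0 : 0 ≤ ρ) (hρ1 : ρ ≤ 1 / 2)
    (hμ0 : 0 < μ) (hμ1 : μ ≤ 2 * π) (g : ℕ → ℕ → ℝ → ℝ)
    (hg : ∀ k s : ℕ, s ≤ k → ∀ θ : ℝ,
      g k s θ = genBinom β k * (Nat.choose k s : ℝ) * (1 / (2 * π)) ^ (β - (k : ℝ)) *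
        (ρ / π) ^ k * θ ^ (β - (k : ℝ)) *
        ((Real.sin μ) ^ s * (Real.sin (θ - μ)) ^ (k - s + 1) *
            (if |Real.sin (θ - μ)| ≥ |Real.sin μ| then (1 : ℝ) else 0) +
          (Real.sin μ) ^ (k - s) * (Real.sin (θ - μ)) ^ (s + 1) *
            (1 - if |Real.sin (θ - μ)| ≥ |Real.sin μ| then (1 : ℝ) else 0)))
    (hint : ∀ k s : ℕ, s ≤ k → IntegrableOn (g k s) (Set.Ioo 0 (2 * π)) volume)
    (hsum : Summable fun k : ℕ =>
      ∑ s ∈ Finset.range (k + 1), ∫ θ in (0 : ℝ)..(2 * π), |g k s θ|) :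
    ∫ θ in (0 : ℝ)..(2 * π),
        Real.cos (θ - μ) *
          ((β / (2 * π)) *
            (θ / (2 * π) + (ρ / π) * (Real.sin (θ - μ) + Real.sin μ)) ^ (β - 1) *
            (1 + 2 * ρ * Real.cos (θ - μ))) =
      Real.cos μ +
        ∑' k : ℕ, ∑ s ∈ Finset.range (k + 1), ∫ θ in (0 : ℝ)..(2 * π), g k s θ := by
  have hpi := Real.pi_pos
  have hle : (0 : ℝ) ≤ 2 * π := by positivity
  rw [ec_parts β ρ μ hβ hρ0 hρ1]
  congr 1
  simp only [intervalIntegral.integral_of_le hle, integral_Ioc_eq_integral_Ioo] at hsum ⊢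
  have hG : ∀ k : ℕ, Integrable (fun θ => ∑ s ∈ Finset.range (k + 1), g k s θ)
      (volume.restrict (Set.Ioo 0 (2 * π))) := fun k =>
    integrable_finsetSum _ fun s hs => hint k s (Nat.lt_succ_iff.1 (Finset.mem_range.1 hs))
  have hGs : Summable fun k : ℕ => ∫ θ in Set.Ioo 0 (2 * π),
      ‖∑ s ∈ Finset.range (k + 1), g k s θ‖ := by
    refine Summable.of_nonneg_of_le (fun k => integral_nonneg fun _ => norm_nonneg _)
      (fun k => ?_) hsum
    have hi : ∀ s ∈ Finset.range (k + 1), Integrable (fun θ => |g k s θ|)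
      (volume.restrict (Set.Ioo 0 (2 * π))) := fun s hs =>
        (hint k s (Nat.lt_succ_iff.1 (Finset.mem_range.1 hs))).abs
    rw [← integral_finsetSum _ hi]
    exact integral_mono (hG k).norm (integrable_finsetSum _ hi)
      fun θ => Finset.abs_sum_le_sum_abs _ _
  have key := hasSum_integral_of_summable_integral_norm hG hGs
  have e : ∀ k : ℕ, ∑ s ∈ Finset.range (k + 1), ∫ θ in Set.Ioo 0 (2 * π), g k s θ =
      ∫ θ in Set.Ioo 0 (2 * π), ∑ s ∈ Finset.range (k + 1), g k s θ := fun k =>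
    (integral_finsetSum _ fun s hs =>
      hint k s (Nat.lt_succ_iff.1 (Finset.mem_range.1 hs))).symm
  simp only [e]
  rw [key.tsum_eq]
  refine setIntegral_congr_fun measurableSet_Ioo fun θ hθ => ?_
  have hθ0 : 0 < θ := hθ.1
  have hx : 0 < θ / (2 * π) := by positivity
  have hy := ec_abs_lt ρ μ θ hρ0 hρ1 hθ.1 hθ.2
  have hsumk : ∀ k : ℕ, ∑ s ∈ Finset.range (k + 1), g k s θ =
      Real.sin (θ - μ) * (θ / (2 * π)) ^ β * (genBinom β k *
        (((ρ / π) * (Real.sin (θ - μ) + Real.sin μ)) / (θ / (2 * π))) ^ k) := by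
    intro k
    have hp : (1 / (2 * π)) ^ (β - (k : ℝ)) * θ ^ (β - (k : ℝ)) =
        (θ / (2 * π)) ^ β / (θ / (2 * π)) ^ k := by
      rw [← Real.mul_rpow (by positivity) hθ0.le, one_div_mul_eq_div, Real.rpow_sub hx,
        Real.rpow_natCast]
    have hb : ∑ s ∈ Finset.range (k + 1), g k s θ =
        genBinom β k * ((1 / (2 * π)) ^ (β - (k : ℝ)) * θ ^ (β - (k : ℝ))) * (ρ / π) ^ k *
          (Real.sin (θ - μ) * (Real.sin (θ - μ) + Real.sin μ) ^ k) := by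
      by_cases hM : |Real.sin (θ - μ)| ≥ |Real.sin μ|
      · rw [add_comm (Real.sin (θ - μ)) (Real.sin μ), add_pow, Finset.mul_sum, Finset.mul_sum]
        refine Finset.sum_congr rfl fun s hs => ?_
        rw [hg k s (Nat.lt_succ_iff.1 (Finset.mem_range.1 hs)) θ, if_pos hM]
        ring
      · rw [add_pow, Finset.mul_sum, Finset.mul_sum]
        refine Finset.sum_congr rfl fun s hs => ?_
        rw [hg k s (Nat.lt_succ_iff.1 (Finset.mem_range.1 hs)) θ, if_neg hM]
        ring
    rw [hb, hp, div_pow (ρ / π * (Real.sin (θ - μ) + Real.sin μ)), mul_pow (ρ / π)]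
    ring
  have hz : |((ρ / π) * (Real.sin (θ - μ) + Real.sin μ)) / (θ / (2 * π))| < 1 := by
    rw [abs_div, abs_of_pos hx, div_lt_one hx]
    exact hy
  have hfin := (genBinom_hasSum β _ hz).mul_left (Real.sin (θ - μ) * (θ / (2 * π)) ^ β)
  simp only [hsumk]
  rw [hfin.tsum_eq, mul_assoc, ← Real.mul_rpow hx.le (by linarith [(abs_lt.1 hz).1]), mul_add (θ / (2 * π)),
    mul_one, mul_div_cancel₀ _ hx.ne']
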